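/- Let L1, L2, L3 be Lagrangian subspaces of a real symplectic vector space (E, ω) and set F = (L1∩L2) + (L2∩L3) + (L3∩L1). Then |s(L1,L2,L3)| ≤ (1/2) dim E^F, where E^F := (F + F^ω)/(F ∩ F^ω) is the symplectic reduction of E by F. -/

import Mathlib

open LinearMap (BilinForm)

variable {E : Type*} [AddCommGroup E] [Module ℝ E]

/-- A subspace is Lagrangian iff it equals its symplectic orthogonal. -/
def IsLagrangian (ω : BilinForm ℝ E) (L : Submodule ℝ E) : Prop :=
  LinearMap.BilinForm.orthogonal ω L = L

/-- Maximal dimension of a subspace on which the function `Q` is positive away from `0`. -/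
noncomputable def posIndex {V : Type*} [AddCommGroup V] [Module ℝ V] (Q : V → ℝ) : ℕ :=
  sSup {d : ℕ | ∃ W : Submodule ℝ V, Module.finrank ℝ W = d ∧ ∀ x ∈ W, x ≠ 0 → 0 < Q x}

/-- The quadratic form `Q(L1,L2,L3)` of a triplet of subspaces,
`Q(x1,x2,x3) = ω(x1,x2) + ω(x2,x3) + ω(x3,x1)`. -/
def tripleQ (ω : BilinForm ℝ E) (L1 L2 L3 : Submodule ℝ E) (v : L1 × L2 × L3) : ℝ :=
  ω v.1 v.2.1 + ω v.2.1 v.2.2 + ω v.2.2 v.1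

/-- The signature `s(L1,L2,L3)` of a triplet of subspaces:  the signature (number of positive
squares minus number of negative squares in a diagonalization) of `Q(L1,L2,L3)`, computed as the
maximal dimension of a subspace on which the form is positive definite minus the maximal dimension
of a subspace on which it is negative definite. -/
noncomputable def tripleSig (ω : BilinForm ℝ E) (L1 L2 L3 : Submodule ℝ E) : ℤ :=
  (posIndex (tripleQ ω L1 L2 L3) : ℤ) - (posIndex (fun v => - tripleQ ω L1 L2 L3 v) : ℤ)

/-- `posIndex` agrees with `sigPos` on quadratic forms. -/
theorem posIndex_eq_sigPos {V : Type*} [AddCommGroup V] [Module ℝ V] [FiniteDimensional ℝ V]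
    (Q : QuadraticForm ℝ V) : posIndex Q = sigPos Q := by
  refine Eq.trans ?_ (sigPos_isGreatest Q).csSup_eq
  unfold posIndex QuadraticMap.PosDef
  simp [QuadraticMap.restrict_apply]

/-- A quadratic form with an isotropic subspace `N` has a small signature. -/
theorem abs_sigPos_sub_sigNeg_le {V : Type*} [AddCommGroup V] [Module ℝ V]
    [FiniteDimensional ℝ V] (Q : QuadraticForm ℝ V) (N : Submodule ℝ V) (hN : ∀ x ∈ N, Q x = 0) :
    |(sigPos Q : ℤ) - sigNeg Q| ≤
      Module.finrank ℝ V + Module.finrank ℝ Q.radical - 2 * Module.finrank ℝ N := by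
  have hp := QuadraticForm.sigPos_add_finrank_le_of_nonpos (Q := Q) fun x hx => (hN x hx).le
  have hn := QuadraticForm.sigPos_add_finrank_le_of_nonpos (Q := -Q) (V := N) fun x hx => by
    simp [hN x hx]
  have hr := QuadraticForm.sigPos_add_sigNeg_add_radical (Q := Q)
  rw [sigPos_neg] at hn
  rw [abs_le]
  omega

/-- `tripleQ` as a bundled quadratic form. -/
noncomputable def tripleForm (ω : BilinForm ℝ E) (L1 L2 L3 : Submodule ℝ E) :
    QuadraticForm ℝ (L1 × L2 × L3) :=
  let p1 := L1.subtype ∘ₗ LinearMap.fst ℝ L1 (L2 × L3)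
  let p2 := L2.subtype ∘ₗ LinearMap.fst ℝ L2 L3 ∘ₗ LinearMap.snd ℝ L1 (L2 × L3)
  let p3 := L3.subtype ∘ₗ LinearMap.snd ℝ L2 L3 ∘ₗ LinearMap.snd ℝ L1 (L2 × L3)
  LinearMap.BilinMap.toQuadraticMap
    (ω.compl₁₂ p1 p2 + ω.compl₁₂ p2 p3 + ω.compl₁₂ p3 p1)

theorem tripleForm_apply (ω : BilinForm ℝ E) (L1 L2 L3 : Submodule ℝ E) (v : L1 × L2 × L3) :
    tripleForm ω L1 L2 L3 v = tripleQ ω L1 L2 L3 v :=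
  rfl

theorem polar_tripleForm {ω : BilinForm ℝ E} (halt : ω.IsAlt) (L1 L2 L3 : Submodule ℝ E)
    (v w : L1 × L2 × L3) :
    QuadraticMap.polar (tripleForm ω L1 L2 L3) v w =
      ω w.1 (v.2.1 - v.2.2) + ω w.2.1 (v.2.2 - v.1) + ω w.2.2 (v.1 - v.2.1) := by
  have h (x y : E) : ω x y = -ω y x := (LinearMap.IsAlt.neg halt y x).symm
  simp only [QuadraticMap.polar, tripleForm_apply, tripleQ, Prod.fst_add, Prod.snd_add,
    Submodule.coe_add, map_add, map_sub, LinearMap.add_apply]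
  rw [h v.1 w.2.1, h v.2.1 w.2.2, h v.2.2 w.1]
  ring

theorem IsLagrangian.mem_iff {ω : BilinForm ℝ E} {L : Submodule ℝ E} (h : IsLagrangian ω L)
    {x : E} : x ∈ L ↔ ∀ y ∈ L, ω y x = 0 := by
  conv_lhs => rw [← h]
  rfl

theorem IsLagrangian.two_mul_finrank [FiniteDimensional ℝ E] {ω : BilinForm ℝ E}
    (hnd : ω.Nondegenerate) {L : Submodule ℝ E} (h : IsLagrangian ω L) :
    2 * Module.finrank ℝ L = Module.finrank ℝ E := by
  have h1 := LinearMap.BilinForm.finrank_orthogonal hnd L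
  have h2 := L.finrank_le
  rw [h] at h1
  omega

theorem mem_radical_tripleForm {ω : BilinForm ℝ E} (halt : ω.IsAlt) {L1 L2 L3 : Submodule ℝ E}
    (h1 : IsLagrangian ω L1) (h2 : IsLagrangian ω L2) (h3 : IsLagrangian ω L3)
    {v : L1 × L2 × L3} :
    v ∈ (tripleForm ω L1 L2 L3).radical ↔
      (v.2.1 - v.2.2 : E) ∈ L1 ∧ (v.2.2 - v.1 : E) ∈ L2 ∧ (v.1 - v.2.1 : E) ∈ L3 := by
  rw [QuadraticMap.radical_eq_ker_polarBilin, LinearMap.mem_ker, LinearMap.ext_iff,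
    h1.mem_iff, h2.mem_iff, h3.mem_iff]
  simp only [QuadraticMap.polarBilin_apply_apply, polar_tripleForm halt, LinearMap.zero_apply]
  refine ⟨fun h => ⟨fun y hy => ?_, fun y hy => ?_, fun y hy => ?_⟩, fun h w => ?_⟩
  · simpa using h (⟨y, hy⟩, 0, 0)
  · simpa using h (0, ⟨y, hy⟩, 0)
  · simpa using h (0, 0, ⟨y, hy⟩)
  · rw [h.1 _ w.1.2, h.2.1 _ w.2.1.2, h.2.2 _ w.2.2.2]
    simp

theorem finrank_add_two_mul_finrank_inf_le_radical [FiniteDimensional ℝ E] {ω : BilinForm ℝ E}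
    (halt : ω.IsAlt) {L1 L2 L3 : Submodule ℝ E}
    (h1 : IsLagrangian ω L1) (h2 : IsLagrangian ω L2) (h3 : IsLagrangian ω L3) :
    Module.finrank ℝ ↥((L1 ⊓ L2) ⊔ (L2 ⊓ L3) ⊔ (L3 ⊓ L1)) +
        2 * Module.finrank ℝ ↥(L1 ⊓ L2 ⊓ L3) ≤
      Module.finrank ℝ (tripleForm ω L1 L2 L3).radical := by
  set R := (tripleForm ω L1 L2 L3).radical
  have hR {v : L1 × L2 × L3} := mem_radical_tripleForm halt h1 h2 h3 (v := v)
  let σ : L1 × L2 × L3 →ₗ[ℝ] E := L1.subtype.coprod (L2.subtype.coprod L3.subtype)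
  have hσ (v : L1 × L2 × L3) : σ v = v.1 + (v.2.1 + v.2.2) := rfl
  let τ := σ.domRestrict R
  have hrange : (L1 ⊓ L2) ⊔ (L2 ⊓ L3) ⊔ (L3 ⊓ L1) ≤ LinearMap.range τ := by
    have half (x : E) : (2⁻¹ : ℝ) • x + (2⁻¹ : ℝ) • x = x := by rw [← add_smul]; norm_num
    refine sup_le (sup_le ?_ ?_) ?_ <;> rintro x ⟨hx, hx'⟩ <;>
      replace hx := Submodule.smul_mem _ (2⁻¹ : ℝ) hx <;>
      replace hx' := Submodule.smul_mem _ (2⁻¹ : ℝ) hx'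
    · exact ⟨⟨(⟨_, hx⟩, ⟨_, hx'⟩, 0), hR.2 (by simp_all)⟩, by simp [τ, hσ, half]⟩
    · exact ⟨⟨(0, ⟨_, hx⟩, ⟨_, hx'⟩), hR.2 (by simp_all)⟩, by simp [τ, hσ, half]⟩
    · exact ⟨⟨(⟨_, hx'⟩, 0, ⟨_, hx⟩), hR.2 (by simp_all)⟩, by simp [τ, hσ, half]⟩
  set D := L1 ⊓ L2 ⊓ L3
  let i1 : D →ₗ[ℝ] L1 := Submodule.inclusion (inf_le_left.trans inf_le_left)
  let i2 : D →ₗ[ℝ] L2 := Submodule.inclusion (inf_le_left.trans inf_le_right)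
  let i3 : D →ₗ[ℝ] L3 := Submodule.inclusion inf_le_right
  let f : D × D →ₗ[ℝ] L1 × L2 × L3 :=
    (i1 ∘ₗ LinearMap.fst ℝ D D).prod ((i2 ∘ₗ LinearMap.snd ℝ D D).prod
      (-(i3 ∘ₗ (LinearMap.fst ℝ D D + LinearMap.snd ℝ D D))))
  have hf (p : D × D) : f p = (i1 p.1, i2 p.2, -(i3 (p.1 + p.2))) := rfl
  have hfR (p : D × D) : f p ∈ R := by
    obtain ⟨⟨a, ⟨ha1, ha2⟩, ha3⟩, ⟨b, ⟨hb1, hb2⟩, hb3⟩⟩ := p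
    refine hR.2 ⟨?_, ?_, ?_⟩
    · exact L1.sub_mem hb1 (L1.neg_mem (L1.add_mem ha1 hb1))
    · exact L2.sub_mem (L2.neg_mem (L2.add_mem ha2 hb2)) ha2
    · exact L3.sub_mem ha3 hb3
  let g : D × D →ₗ[ℝ] LinearMap.ker τ := (f.codRestrict R hfR).codRestrict _ fun p => by
    change (p.1 : E) + ((p.2 : E) + -((p.1 : E) + p.2)) = 0
    abel
  have hg : Function.Injective g := by
    intro p q h
    have h' : f p = f q := congrArg (fun z : LinearMap.ker τ => ((z : R) : L1 × L2 × L3)) h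
    rw [hf, hf, Prod.mk.injEq, Prod.mk.injEq] at h'
    exact Prod.ext (Submodule.inclusion_injective _ h'.1)
      (Submodule.inclusion_injective _ h'.2.1)
  have e1 := LinearMap.finrank_range_add_finrank_ker τ
  have e2 := Submodule.finrank_mono hrange
  have e3 := LinearMap.finrank_le_finrank_of_injective hg
  rw [Module.finrank_prod] at e3
  omega

theorem exists_isotropic_tripleForm [FiniteDimensional ℝ E] {ω : BilinForm ℝ E}
    (halt : ω.IsAlt) {L1 L2 L3 : Submodule ℝ E}
    (h1 : IsLagrangian ω L1) (h2 : IsLagrangian ω L2) (h3 : IsLagrangian ω L3) :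
    ∃ N : Submodule ℝ (L1 × L2 × L3), (∀ x ∈ N, tripleForm ω L1 L2 L3 x = 0) ∧
      Module.finrank ℝ L1 + Module.finrank ℝ (tripleForm ω L1 L2 L3).radical ≤
        Module.finrank ℝ N + Module.finrank ℝ ↥(L1 ⊓ L2 ⊓ L3) := by
  set R := (tripleForm ω L1 L2 L3).radical
  let P := LinearMap.range (LinearMap.inl ℝ L1 (L2 × L3))
  refine ⟨R ⊔ P, fun x hx => ?_, ?_⟩
  · obtain ⟨r, hr, _, ⟨y, rfl⟩, rfl⟩ := Submodule.mem_sup.1 hx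
    rw [(QuadraticMap.mem_radical_iff'.1 hr).2]
    simp [tripleForm_apply, tripleQ]
  · have hinf : R ⊓ P ≤
        ((L1 ⊓ L2 ⊓ L3).comap L1.subtype).map (LinearMap.inl ℝ L1 (L2 × L3)) := by
      rintro _ ⟨hx, ⟨y, rfl⟩⟩
      obtain ⟨-, hy2, hy3⟩ := (mem_radical_tripleForm halt h1 h2 h3).1 hx
      exact ⟨y, ⟨⟨y.2, by simpa using hy2⟩, by simpa using hy3⟩, rfl⟩
    have e1 := Submodule.finrank_sup_add_finrank_inf_eq R P
    have e2 := (Submodule.finrank_mono hinf).trans (Submodule.finrank_map_le _ _)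
    have e3 := (Submodule.comapSubtypeEquivOfLe
      (show L1 ⊓ L2 ⊓ L3 ≤ L1 from inf_le_left.trans inf_le_left)).finrank_eq
    have e4 : Module.finrank ℝ P = Module.finrank ℝ L1 :=
      LinearMap.finrank_range_of_inj LinearMap.inl_injective
    omega

theorem finrank_le_finrank_reduction [FiniteDimensional ℝ E] {ω : BilinForm ℝ E}
    (hnd : ω.Nondegenerate) (F : Submodule ℝ E) :
    Module.finrank ℝ E ≤
      Module.finrank ℝ (↥(F ⊔ ω.orthogonal F) ⧸
        (F ⊓ ω.orthogonal F).comap (F ⊔ ω.orthogonal F).subtype) + 2 * Module.finrank ℝ F := by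
  have e1 := Submodule.finrank_quotient_add_finrank
    ((F ⊓ ω.orthogonal F).comap (F ⊔ ω.orthogonal F).subtype)
  have e2 := (Submodule.comapSubtypeEquivOfLe
    (show F ⊓ ω.orthogonal F ≤ F ⊔ ω.orthogonal F from inf_le_left.trans le_sup_left)).finrank_eq
  have e3 := Submodule.finrank_sup_add_finrank_inf_eq F (ω.orthogonal F)
  have e4 := LinearMap.BilinForm.finrank_orthogonal hnd F
  have e5 := Submodule.finrank_mono (inf_le_left : F ⊓ ω.orthogonal F ≤ F)
  have e6 := F.finrank_le
  omega

/-- `|s(L1,L2,L3)| ≤ (1/2) dim E^F` where `F = (L1∩L2)+(L2∩L3)+(L3∩L1)` and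
`E^F = (F + F^ω)/(F ∩ F^ω)` is the symplectic reduction of `E` by `F`.  (Stated equivalently as
`2 |s(L1,L2,L3)| ≤ dim E^F`.) -/
theorem signature_bound [FiniteDimensional ℝ E]
    (ω : BilinForm ℝ E) (halt : LinearMap.IsAlt ω)
    (hnd : LinearMap.BilinForm.Nondegenerate ω)
    (L1 L2 L3 : Submodule ℝ E)
    (h1 : IsLagrangian ω L1) (h2 : IsLagrangian ω L2) (h3 : IsLagrangian ω L3)
    (F : Submodule ℝ E) (hF : F = (L1 ⊓ L2) ⊔ (L2 ⊓ L3) ⊔ (L3 ⊓ L1)) :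
    2 * |tripleSig ω L1 L2 L3| ≤
      (Module.finrank ℝ
        (↥(F ⊔ LinearMap.BilinForm.orthogonal ω F) ⧸
          Submodule.comap (F ⊔ LinearMap.BilinForm.orthogonal ω F).subtype
            (F ⊓ LinearMap.BilinForm.orthogonal ω F)) : ℤ) := by
  have hsig : tripleSig ω L1 L2 L3 = (sigPos (tripleForm ω L1 L2 L3) : ℤ) -
      sigNeg (tripleForm ω L1 L2 L3) := by
    rw [← sigPos_neg, ← posIndex_eq_sigPos, ← posIndex_eq_sigPos]
    rfl
  obtain ⟨N, hN, hdim⟩ := exists_isotropic_tripleForm halt h1 h2 h3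
  have e1 := abs_sigPos_sub_sigNeg_le _ N hN
  have e2 := finrank_add_two_mul_finrank_inf_le_radical halt h1 h2 h3
  have e3 := finrank_le_finrank_reduction hnd F
  have n1 := h1.two_mul_finrank hnd
  have n2 := h2.two_mul_finrank hnd
  have n3 := h3.two_mul_finrank hnd
  rw [← hF] at e2
  rw [← hsig, Module.finrank_prod, Module.finrank_prod] at e1
  push_cast at e1
  omega
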